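/- Let $M$ be a smooth manifold of dimension $2n+1$ with a smooth Riemannian metric $g$, Levi-Civita connection $\nabla$, curvature $R(X,Y)Z=\nabla_X\nabla_YZ-\nabla_Y\nabla_XZ-\nabla_{[X,Y]}Z$ and Ricci tensor $S(X,Y)=\operatorname{tr}\bigl(Z\mapsto R(Z,X)Y\bigr)$. Let $\varphi$ be a smooth $(1,1)$-tensor field, $\xi$ a smooth vector field and $\eta$ a smooth $1$-form on $M$ such that $(M,g,\varphi,\xi,\eta)$ is a Kenmotsu manifold, that is, for all vector fields $X,Y$, $$\varphi^2=-I+\eta\otimes\xi,\quad \eta(\xi)=1,\quad \eta(X)=g(X,\xi),\quad g(\varphi X,\varphi Y)=g(X,Y)-\eta(X)\eta(Y),$$ $$(\nabla_X\varphi)Y=g(\varphi X,Y)\,\xi-\eta(Y)\,\varphi X .$$ Let $(g,V,\lambda,\mu)$ be a gradient conformal $\eta$-Ricci soliton on $M$ with potential function $f$ and conformal pressure $p$, that is, $f$ is a smooth function on $M$, $V=Df$ is its gradient, $\lambda,\mu,p$ are real constants, and $$\operatorname{Hess}f+S+\Bigl[\lambda-\Bigl(\frac p2+\frac1{2n+1}\Bigr)\Bigr]g+\mu\,\eta\otimes\eta=0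 .$$ Then $V=Df$ is pointwise collinear with $\xi$; precisely, $Df=(\xi f)\,\xi$, i.e. $Xf=(\xi f)\,\eta(X)$ for every vector field $X$. -/

import Mathlib

open Bundle
open scoped Manifold ContDiff

noncomputable section

set_option linter.unusedSectionVars false

section LeviCivita

variable {E : Type*} [NormedAddCommGroup E] [NormedSpace ℝ E] [FiniteDimensional ℝ E]
  {H : Type*} [TopologicalSpace H] {I : ModelWithCorners ℝ E H}
  {M : Type*} [TopologicalSpace M] [ChartedSpace H M] [IsManifold I ∞ M]
  [RiemannianBundle (fun x : M ↦ TangentSpace I x)]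
  [IsContMDiffRiemannianBundle I ∞ E (fun x : M ↦ TangentSpace I x)]

/-- The right-hand side of the Koszul formula for `2 g(∇_X Y, Z)` at `x`. -/
def koszul (X Y Z : Π x : M, TangentSpace I x) (x : M) : ℝ :=
  mvfderiv I (fun y ↦ inner ℝ (Y y) (Z y)) x (X x)
    + mvfderiv I (fun y ↦ inner ℝ (Z y) (X y)) x (Y x)
    - mvfderiv I (fun y ↦ inner ℝ (X y) (Y y)) x (Z x)
    + inner ℝ (VectorField.mlieBracket I X Y x) (Z x)
    - inner ℝ (VectorField.mlieBracket I X Z x) (Y x)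
    - inner ℝ (VectorField.mlieBracket I Y Z x) (X x)


theorem mdiffAt_inner {X Y : Π x : M, TangentSpace I x} {x : M}
    (hX : MDiffAt (T% X) x) (hY : MDiffAt (T% Y) x) :
    MDiffAt (fun y ↦ inner ℝ (X y) (Y y)) x :=
  MDifferentiableAt.inner_bundle (IB := I) (F := E) (E := fun x : M ↦ TangentSpace I x) hX hY

theorem mvfderiv_inner_smul {f : M → ℝ} {X Y : Π x : M, TangentSpace I x} {x : M}
    (hf : MDiffAt f x) (hX : MDiffAt (T% X) x) (hY : MDiffAt (T% Y) x) (v : TangentSpace I x) :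
    mvfderiv I (fun y ↦ inner ℝ ((f • X) y) (Y y)) x v =
      f x * mvfderiv I (fun y ↦ inner ℝ (X y) (Y y)) x v + inner ℝ (X x) (Y x) * mvfderiv I f x v := by
  have e : (fun y ↦ inner ℝ ((f • X) y) (Y y)) = f * fun y ↦ inner ℝ (X y) (Y y) := by
    ext y; simp [inner_smul_left]
  rw [e, mvfderiv_mul hf (mdiffAt_inner hX hY)]
  rfl

theorem mvfderiv_inner_add {X X' Y : Π x : M, TangentSpace I x} {x : M}
    (hX : MDiffAt (T% X) x) (hX' : MDiffAt (T% X') x) (hY : MDiffAt (T% Y) x)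
    (v : TangentSpace I x) :
    mvfderiv I (fun y ↦ inner ℝ ((X + X') y) (Y y)) x v =
      mvfderiv I (fun y ↦ inner ℝ (X y) (Y y)) x v
        + mvfderiv I (fun y ↦ inner ℝ (X' y) (Y y)) x v := by
  have e : (fun y ↦ inner ℝ ((X + X') y) (Y y)) =
      (fun y ↦ inner ℝ (X y) (Y y)) + fun y ↦ inner ℝ (X' y) (Y y) := by
    ext y; simp [inner_add_left]
  rw [e, mvfderiv_add (mdiffAt_inner hX hY) (mdiffAt_inner hX' hY)]
  rfl

theorem mvfderiv_inner_comm (X Y : Π x : M, TangentSpace I x) (x : M) (v : TangentSpace I x) :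
    mvfderiv I (fun y ↦ inner ℝ (X y) (Y y)) x v =
      mvfderiv I (fun y ↦ inner ℝ (Y y) (X y)) x v := by
  simp only [real_inner_comm]

theorem koszul_tensorial_left {Y Z : Π x : M, TangentSpace I x} {x : M}
    (hY : MDiffAt (T% Y) x) (hZ : MDiffAt (T% Z) x) :
    TensorialAt I E (koszul · Y Z x) x where
  smul {f X} hf hX := by
    simp only [koszul, VectorField.mlieBracket_smul_left hf hX, mvfderiv_inner_smul hf hX hY,
      mvfderiv_inner_comm Z (f • X), mvfderiv_inner_smul hf hX hZ, mvfderiv_inner_comm Z X]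
    simp only [Pi.smul_apply', map_smul, smul_eq_mul, inner_add_left, real_inner_smul_left,
      real_inner_smul_right]
    ring
  add {X X'} hX hX' := by
    simp only [koszul, VectorField.mlieBracket_add_left hX hX', mvfderiv_inner_add hX hX' hY,
      mvfderiv_inner_comm Z (X + X'), mvfderiv_inner_add hX hX' hZ, mvfderiv_inner_comm Z X,
      mvfderiv_inner_comm Z X']
    simp only [Pi.add_apply, map_add, inner_add_left, inner_add_right]
    ring

theorem koszul_tensorial_right {X Y : Π x : M, TangentSpace I x} {x : M}
    (hX : MDiffAt (T% X) x) (hY : MDiffAt (T% Y) x) :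
    TensorialAt I E (koszul X Y · x) x where
  smul {f Z} hf hZ := by
    simp only [koszul, VectorField.mlieBracket_smul_right hf hZ, mvfderiv_inner_smul hf hZ hX,
      mvfderiv_inner_comm Y (f • Z), mvfderiv_inner_smul hf hZ hY, mvfderiv_inner_comm Z Y]
    simp only [Pi.smul_apply', map_smul, smul_eq_mul, inner_add_left, real_inner_smul_left,
      real_inner_smul_right, real_inner_comm]
    ring
  add {Z Z'} hZ hZ' := by
    simp only [koszul, VectorField.mlieBracket_add_right hZ hZ', mvfderiv_inner_add hZ hZ' hX,
      mvfderiv_inner_comm Y (Z + Z'), mvfderiv_inner_add hZ hZ' hY, mvfderiv_inner_comm Z Y,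
      mvfderiv_inner_comm Z' Y]
    simp only [Pi.add_apply, map_add, inner_add_left, inner_add_right]
    ring

theorem koszul_smul_middle {f : M → ℝ} {X Y Z : Π x : M, TangentSpace I x} {x : M}
    (hf : MDiffAt f x) (hX : MDiffAt (T% X) x) (hY : MDiffAt (T% Y) x) (hZ : MDiffAt (T% Z) x) :
    koszul X (f • Y) Z x =
      f x * koszul X Y Z x + 2 * (mvfderiv I f x (X x) * inner ℝ (Y x) (Z x)) := by
  simp only [koszul, VectorField.mlieBracket_smul_left hf hY,
    VectorField.mlieBracket_smul_right hf hY, mvfderiv_inner_smul hf hY hZ,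
    mvfderiv_inner_comm X (f • Y), mvfderiv_inner_smul hf hY hX, mvfderiv_inner_comm X Y]
  simp only [Pi.smul_apply', map_smul, smul_eq_mul, inner_add_left, real_inner_smul_left,
    real_inner_smul_right, real_inner_comm]
  ring

theorem koszul_add_middle {X Y Y' Z : Π x : M, TangentSpace I x} {x : M}
    (hX : MDiffAt (T% X) x) (hY : MDiffAt (T% Y) x) (hY' : MDiffAt (T% Y') x)
    (hZ : MDiffAt (T% Z) x) :
    koszul X (Y + Y') Z x = koszul X Y Z x + koszul X Y' Z x := by
  simp only [koszul, VectorField.mlieBracket_add_left hY hY',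
    VectorField.mlieBracket_add_right hY hY', mvfderiv_inner_add hY hY' hZ,
    mvfderiv_inner_comm X (Y + Y'), mvfderiv_inner_add hY hY' hX, mvfderiv_inner_comm X Y,
    mvfderiv_inner_comm X Y']
  simp only [Pi.add_apply, map_add, inner_add_left, inner_add_right]
  ring

/-- Tangent spaces of a finite-dimensional manifold are finite-dimensional. -/
instance instFiniteDimensionalTangentSpace (x : M) : FiniteDimensional ℝ (TangentSpace I x) :=
  VectorBundle.finiteDimensional ℝ E (fun x : M ↦ TangentSpace I x) x

open scoped Classical in
/-- `(Y, x) ↦ (∇Y)(x)`, where `g(∇_X Y, Z)` is half the right-hand side of the Koszul formula;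
the junk value `0` is used where `Y` is not differentiable. -/
def leviCivitaFun (Y : Π x : M, TangentSpace I x) (x : M) :
    TangentSpace I x →L[ℝ] TangentSpace I x :=
  if hY : MDiffAt (T% Y) x then
    LinearMap.toContinuousLinearMap
      ((InnerProductSpace.toDual ℝ (TangentSpace I x)).symm.toLinearMap ∘ₗ
        (((1 / 2 : ℝ) • TensorialAt.mkHom₂ (I := I) (F := E) (F' := E)
          (V := fun x : M ↦ TangentSpace I x) (V' := fun x : M ↦ TangentSpace I x)
          (koszul · Y · x) x
          (fun _ hZ ↦ koszul_tensorial_left hY hZ)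
          (fun _ hX ↦ koszul_tensorial_right hX hY)).toLinearMap))
  else 0

theorem inner_leviCivitaFun {X Y Z : Π x : M, TangentSpace I x} {x : M}
    (hX : MDiffAt (T% X) x) (hY : MDiffAt (T% Y) x) (hZ : MDiffAt (T% Z) x) :
    inner ℝ (leviCivitaFun Y x (X x)) (Z x) = 1 / 2 * koszul X Y Z x := by
  simp only [leviCivitaFun, hY, dif_pos]
  change inner ℝ ((InnerProductSpace.toDual ℝ (TangentSpace I x)).symm _) (Z x) = _
  rw [InnerProductSpace.toDual_symm_apply]
  change (1 / 2 : ℝ) * _ = _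
  congr 1
  exact TensorialAt.mkHom₂_apply (I := I) (F := E) (F' := E)
    (V := fun x : M ↦ TangentSpace I x) (V' := fun x : M ↦ TangentSpace I x)
    (fun _ hZ ↦ koszul_tensorial_left hY hZ) (fun _ hX ↦ koszul_tensorial_right hX hY) hX hZ

theorem eq_of_inner_fields {x : M} {v w : TangentSpace I x}
    (h : ∀ Z : Π x : M, TangentSpace I x, MDiffAt (T% Z) x →
      inner ℝ v (Z x) = inner ℝ w (Z x)) : v = w := by
  refine ext_inner_right ℝ fun z ↦ ?_
  have := h (FiberBundle.extend E z)
    (FiberBundle.mdifferentiableAt_extend (V := fun x : M ↦ TangentSpace I x) ..)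
  simpa using this

/-- The Levi-Civita connection of the Riemannian metric; `leviCivita Y x (X x)` is
`(∇_X Y)(x)`. -/
def leviCivita : CovariantDerivative I E (fun x : M ↦ TangentSpace I x) where
  toFun := leviCivitaFun
  isCovariantDerivativeOnUniv :=
    { add := by
        intro Y Y' x hY hY' _
        ext v
        refine eq_of_inner_fields (I := I) fun Z hZ ↦ ?_
        have hX := FiberBundle.mdifferentiableAt_extend (V := fun x : M ↦ TangentSpace I x)
          I E v
        have hv : FiberBundle.extend E v x = v := by simp
        rw [← hv]
        simp only [add_apply, inner_add_left]
        rw [inner_leviCivitaFun hX (mdifferentiableAt_add_section hY hY') hZ,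
          inner_leviCivitaFun hX hY hZ, inner_leviCivitaFun hX hY' hZ,
          koszul_add_middle hX hY hY' hZ]
        ring
      leibniz := by
        intro Y f x hY hf _
        ext v
        refine eq_of_inner_fields (I := I) fun Z hZ ↦ ?_
        have hX := FiberBundle.mdifferentiableAt_extend (V := fun x : M ↦ TangentSpace I x)
          I E v
        have hv : FiberBundle.extend E v x = v := by simp
        rw [← hv]
        simp only [add_apply, smul_apply,
          ContinuousLinearMap.smulRight_apply, inner_add_left, real_inner_smul_left]
        rw [inner_leviCivitaFun hX (hf.smul_section hY) hZ,
          inner_leviCivitaFun hX hY hZ, koszul_smul_middle hf hX hY hZ]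
        ring }

/-- The Levi-Civita connection is torsion-free. -/
theorem leviCivita_torsion :
    (leviCivita : CovariantDerivative I E (fun x : M ↦ TangentSpace I x)).torsion = 0 := by
  rw [CovariantDerivative.torsion_eq_zero_iff]
  intro X Y x hX hY
  refine eq_of_inner_fields (I := I) fun Z hZ ↦ ?_
  rw [inner_sub_left]
  change inner ℝ (leviCivitaFun Y x (X x)) (Z x) - inner ℝ (leviCivitaFun X x (Y x)) (Z x) = _
  rw [inner_leviCivitaFun hX hY hZ, inner_leviCivitaFun hY hX hZ]
  simp only [koszul, VectorField.mlieBracket_swap_apply (V := Y) (W := X), inner_neg_left,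
    mvfderiv_inner_comm Y X, mvfderiv_inner_comm Z X, mvfderiv_inner_comm Z Y]
  ring

/-- The Levi-Civita connection is compatible with the metric. -/
theorem leviCivita_metric {X Y Z : Π x : M, TangentSpace I x} {x : M}
    (hX : MDiffAt (T% X) x) (hY : MDiffAt (T% Y) x) (hZ : MDiffAt (T% Z) x) :
    mvfderiv I (fun y ↦ inner ℝ (Y y) (Z y)) x (X x) =
      inner ℝ (leviCivita Y x (X x)) (Z x) + inner ℝ (Y x) (leviCivita Z x (X x)) := by
  change _ = inner ℝ (leviCivitaFun Y x (X x)) (Z x) + inner ℝ (Y x) (leviCivitaFun Z x (X x))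
  rw [real_inner_comm _ (Y x), inner_leviCivitaFun hX hY hZ, inner_leviCivitaFun hX hZ hY]
  simp only [koszul, VectorField.mlieBracket_swap_apply (V := Z) (W := Y), inner_neg_left,
    mvfderiv_inner_comm Z Y, mvfderiv_inner_comm Z X, mvfderiv_inner_comm Y X]
  ring

/-- The curvature `R(X, Y)Z = ∇_X ∇_Y Z - ∇_Y ∇_X Z - ∇_[X, Y] Z` at `x`. -/
def curvature (X Y Z : Π x : M, TangentSpace I x) (x : M) : TangentSpace I x :=
  leviCivita (fun y ↦ leviCivita Z y (Y y)) x (X x)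
    - leviCivita (fun y ↦ leviCivita Z y (X y)) x (Y x)
    - leviCivita Z x (VectorField.mlieBracket I X Y x)

/-- The Ricci tensor `S(X, Y)` at `x`, the trace of `Z ↦ R(Z, X)Y`, computed in an orthonormal
basis of the tangent space, whose vectors are extended to vector fields that are smooth
near `x`. -/
def ricci (X Y : Π x : M, TangentSpace I x) (x : M) : ℝ :=
  ∑ i, inner ℝ
    (curvature (FiberBundle.extend E (stdOrthonormalBasis ℝ (TangentSpace I x) i)) X Y x)
    (stdOrthonormalBasis ℝ (TangentSpace I x) i)

/-- The gradient `Df`, defined by `g(Df, X) = X f`. -/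
def riemannianGradient (f : M → ℝ) (x : M) : TangentSpace I x :=
  (InnerProductSpace.toDual ℝ (TangentSpace I x)).symm (mvfderiv I f x)

/-- The Hessian `(Hess f)(X, Y) = g(∇_X Df, Y)` at `x`. -/
def hessian (f : M → ℝ) (X Y : Π x : M, TangentSpace I x) (x : M) : ℝ :=
  inner ℝ (leviCivita (riemannianGradient (I := I) f) x (X x)) (Y x)

/-- `(φ, ξ, η)` is an almost contact metric structure on the Riemannian manifold `M`. -/
structure IsAlmostContactMetric (φ : Π x : M, TangentSpace I x →L[ℝ] TangentSpace I x)
    (ξ : Π x : M, TangentSpace I x) (η : Π x : M, TangentSpace I x →L[ℝ] ℝ) : Prop where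
  smooth_phi : ContMDiff I (I.prod 𝓘(ℝ, E →L[ℝ] E)) ∞
    (fun x ↦ TotalSpace.mk' (E →L[ℝ] E)
      (E := fun x : M ↦ TangentSpace I x →L[ℝ] TangentSpace I x) x (φ x))
  smooth_xi : ContMDiff I (I.prod 𝓘(ℝ, E)) ∞
    (fun x ↦ TotalSpace.mk' E (E := fun x : M ↦ TangentSpace I x) x (ξ x))
  smooth_eta : ContMDiff I (I.prod 𝓘(ℝ, E →L[ℝ] ℝ)) ∞
    (fun x ↦ TotalSpace.mk' (E →L[ℝ] ℝ)
      (E := fun x : M ↦ TangentSpace I x →L[ℝ] Trivial M ℝ x) x (η x))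
  phi_phi : ∀ (x : M) (v : TangentSpace I x), φ x (φ x v) = -v + η x v • ξ x
  eta_xi : ∀ x : M, η x (ξ x) = 1
  eta_eq : ∀ (x : M) (v : TangentSpace I x), η x v = inner ℝ v (ξ x)
  inner_phi_phi : ∀ (x : M) (v w : TangentSpace I x),
    inner ℝ (φ x v) (φ x w) = inner ℝ v w - η x v * η x w

/-- `(M, g, φ, ξ, η)` is a Kenmotsu manifold: an almost contact metric manifold with
`(∇_X φ)Y = g(φX, Y)ξ - η(Y)φX`, where `(∇_X φ)Y = ∇_X(φY) - φ(∇_X Y)`. -/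
structure IsKenmotsu (φ : Π x : M, TangentSpace I x →L[ℝ] TangentSpace I x)
    (ξ : Π x : M, TangentSpace I x) (η : Π x : M, TangentSpace I x →L[ℝ] ℝ) : Prop
    extends IsAlmostContactMetric φ ξ η where
  kenmotsu : ∀ X Y : Π x : M, TangentSpace I x, CMDiff ∞ (T% X) → CMDiff ∞ (T% Y) → ∀ x : M,
    leviCivita (fun y ↦ φ y (Y y)) x (X x) - φ x (leviCivita Y x (X x)) =
      (inner ℝ (φ x (X x)) (Y x) : ℝ) • ξ x - η x (Y x) • φ x (X x)

/-- `(g, V, lam, mu)` is a gradient conformal `η`-Ricci soliton with potential function `f` and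
conformal pressure `p`: `V = Df` and
`Hess f + S + [lam - (p/2 + 1/dim M)] g + mu η ⊗ η = 0`. -/
structure IsGradientConformalEtaRicciSoliton (η : Π x : M, TangentSpace I x →L[ℝ] ℝ)
    (V : Π x : M, TangentSpace I x) (f : M → ℝ) (lam mu p : ℝ) : Prop where
  smooth : CMDiff ∞ f
  eq_gradient : V = riemannianGradient f
  soliton : ∀ X Y : Π x : M, TangentSpace I x, CMDiff ∞ (T% X) → CMDiff ∞ (T% Y) → ∀ x : M,
    hessian f X Y x + ricci X Y x
      + (lam - (p / 2 + 1 / (Module.finrank ℝ E : ℝ))) * inner ℝ (X x) (Y x)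
      + mu * (η x (X x) * η x (Y x)) = 0

end LeviCivita

end

set_option linter.unusedSectionVars false

section SmoothFields

open VectorField

variable {E : Type*} [NormedAddCommGroup E] [NormedSpace ℝ E] [FiniteDimensional ℝ E]
  {H : Type*} [TopologicalSpace H] {I : ModelWithCorners ℝ E H}
  {M : Type*} [TopologicalSpace M] [ChartedSpace H M] [IsManifold I ∞ M]

/-- A tangent vector of a Hausdorff manifold extends to a smooth vector field. -/
theorem exists_contMDiff_vectorField_eq [T2Space M] {x : M} (v : TangentSpace I x) :
    ∃ X : Π y : M, TangentSpace I y, CMDiff ∞ (T% X) ∧ X x = v := by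
  obtain ⟨s, hs, hsv⟩ := FiberBundle.exists_contMDiffOn_extend (k := ∞)
    (V := fun y : M ↦ TangentSpace I y) I E v
  obtain ⟨u, hus, hu, hxu⟩ := mem_nhds_iff.1 hs
  obtain ⟨b, hb, -⟩ := (SmoothBumpFunction.nhds_basis_support (I := I) (hu.mem_nhds hxu)).mem_iff.1
    (hu.mem_nhds hxu)
  refine ⟨(b : M → ℝ) • FiberBundle.extend E v,
    ContMDiffOn.smul_section_of_tsupport b.contMDiff.contMDiffOn hu hb (hsv.mono hus), ?_⟩
  simp

/-- The derivative of a smooth function along a smooth vector field is smooth. -/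
theorem contMDiff_mvfderiv_apply {f : M → ℝ} {X : Π x : M, TangentSpace I x}
    (hf : CMDiff ∞ f) (hX : CMDiff ∞ (T% X)) :
    CMDiff ∞ (fun x ↦ mvfderiv I f x (X x)) := by
  have h := (hf.contMDiff_tangentMap (m := ∞) le_rfl).comp hX
  exact (contMDiff_snd_tangentBundle_modelSpace ℝ 𝓘(ℝ, ℝ)).comp h

/-- The Lie bracket of smooth vector fields acts on functions as their commutator. -/
theorem mvfderiv_mlieBracket [T2Space M] {f : M → ℝ} {X Y : Π x : M, TangentSpace I x}
    (hf : CMDiff ∞ f) (hX : CMDiff ∞ (T% X)) (hY : CMDiff ∞ (T% Y)) (x : M) :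
    mvfderiv I f x (mlieBracket I X Y x) =
      mvfderiv I (fun y ↦ mvfderiv I f y (Y y)) x (X x)
        - mvfderiv I (fun y ↦ mvfderiv I f y (X y)) x (Y x) := by
  rcases subsingleton_or_nontrivial (TangentSpace I x) with hs | hs
  · simp [Subsingleton.elim (mlieBracket I X Y x) 0, Subsingleton.elim (X x) 0,
      Subsingleton.elim (Y x) 0]
  obtain ⟨z, hz⟩ := exists_ne (0 : TangentSpace I x)
  obtain ⟨Z, hZ, rfl⟩ := exists_contMDiff_vectorField_eq z
  have : IsManifold I (minSmoothness ℝ 3) M := .of_le (n := ∞) (by simpa using ENat.LEInfty.out)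
  have : IsManifold I ((⊤ : ℕ∞) + 1) M := ‹IsManifold I ∞ M›
  have bracket {U V : Π y : M, TangentSpace I y} (hU : CMDiff ∞ (T% U)) (hV : CMDiff ∞ (T% V)) :
      CMDiff ∞ (T% (mlieBracket I U V)) :=
    ContDiff.mlieBracket_vectorField (m := ⊤) (n := ⊤) hU hV (by simp)
  have expand {U W : Π y : M, TangentSpace I y} (hW : CMDiff ∞ (T% W)) {h : M → ℝ}
      (hh : CMDiff ∞ h) :
      mlieBracket I U (h • W) = (fun y ↦ mvfderiv I h y (U y)) • W + h • mlieBracket I U W := by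
    ext1 y
    exact mlieBracket_smul_right (hh.mdifferentiable (by simp) y) (hW.mdifferentiable (by simp) y)
  have two_le : minSmoothness ℝ 2 ≤ ∞ := by simpa using ENat.LEInfty.out
  have double {U W : Π y : M, TangentSpace I y} (hU : CMDiff ∞ (T% U)) (hW : CMDiff ∞ (T% W)) :
      mlieBracket I W (mlieBracket I U (f • Z)) x =
        mvfderiv I (fun y ↦ mvfderiv I f y (U y)) x (W x) • Z x
          + mvfderiv I f x (U x) • mlieBracket I W Z x
          + (mvfderiv I f x (W x) • mlieBracket I U Z x
            + f x • mlieBracket I W (mlieBracket I U Z) x) := by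
    have hUf := contMDiff_mvfderiv_apply hf hU
    rw [expand hZ hf, mlieBracket_add_right
      ((hUf.smul_section hZ).mdifferentiable (by simp) x)
      ((hf.smul_section (bracket hU hZ)).mdifferentiable (by simp) x),
      expand hZ hUf, expand (bracket hU hZ) hf]
    rfl
  have jacobi := leibniz_identity_mlieBracket_apply (I := I) (hX.of_le two_le x)
    (hY.of_le two_le x) ((hf.smul_section hZ).of_le two_le x)
  have jacobi' := leibniz_identity_mlieBracket_apply (I := I) (hX.of_le two_le x)
    (hY.of_le two_le x) (hZ.of_le two_le x)
  rw [double hY hX, double hX hY, expand hZ hf, jacobi'] at jacobi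
  simp only [Pi.add_apply, Pi.smul_apply'] at jacobi
  refine smul_left_injective ℝ hz ?_
  change _ • _ = _ • _
  linear_combination (norm := module) -jacobi

end SmoothFields

section Gradient

variable {E : Type*} [NormedAddCommGroup E] [NormedSpace ℝ E] [FiniteDimensional ℝ E]
  {H : Type*} [TopologicalSpace H] {I : ModelWithCorners ℝ E H}
  {M : Type*} [TopologicalSpace M] [ChartedSpace H M] [IsManifold I ∞ M]
  [RiemannianBundle (fun x : M ↦ TangentSpace I x)]
  [IsContMDiffRiemannianBundle I ∞ E (fun x : M ↦ TangentSpace I x)]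

theorem inner_riemannianGradient (f : M → ℝ) (x : M) (v : TangentSpace I x) :
    inner ℝ (riemannianGradient f x) v = mvfderiv I f x v :=
  InnerProductSpace.toDual_symm_apply

/-- The gradient of a smooth function is smooth. -/
theorem contMDiff_riemannianGradient {f : M → ℝ} (hf : CMDiff ∞ f) :
    CMDiff ∞ (T% (riemannianGradient (I := I) f)) := by
  intro x
  obtain ⟨g, hg, hgi⟩ := IsContMDiffRiemannianBundle.exists_contMDiff
    (IB := I) (n := ∞) (F := E) (E := fun x : M ↦ TangentSpace I x)
  let e := trivializationAt E (fun x : M ↦ TangentSpace I x) x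
  have hxe : x ∈ e.baseSet := FiberBundle.mem_baseSet_trivializationAt' x
  let A : M → E →L[ℝ] E →L[ℝ] ℝ := fun y ↦ ContinuousLinearMap.inCoordinates E
    (fun x : M ↦ TangentSpace I x) (E →L[ℝ] ℝ) (fun x : M ↦ TangentSpace I x →L[ℝ] ℝ) x y x y (g y)
  have hA : CMDiffAt ∞ A x := ((contMDiffAt_hom_bundle _).1 (hg x)).2
  have A_apply {y : M} (hy : y ∈ e.baseSet) (v w : E) :
      A y v w = inner ℝ (e.symm y v) (e.symm y w) := by
    rw [hgi]
    exact (inCoordinates_apply_eq₂ (𝕜 := ℝ) (ϕ := g y) (E₃ := Trivial M ℝ) (F₃ := ℝ)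
      hy hy (by simp)).trans (by simp; rfl)
  have A_inv {y : M} (hy : y ∈ e.baseSet) : (A y).IsInvertible := by
    have inj : Function.Injective (A y).toLinearMap := by
      rw [← LinearMap.ker_eq_bot, LinearMap.ker_eq_bot']
      intro v hv
      have h0 : inner ℝ (e.symm y v) (e.symm y v) = 0 := by
        rw [← A_apply hy]
        exact congr($hv v)
      rw [inner_self_eq_zero] at h0
      have h1 := e.apply_mk_symm hy v
      rw [h0] at h1
      have h2 := e.apply_mk_symm hy 0
      rw [show e.symm y 0 = 0 by rw [← e.symmL_apply (R := ℝ) hy, map_zero]] at h2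
      simpa using congr(($(h1.symm.trans h2)).2)
    have rank : Module.finrank ℝ E = Module.finrank ℝ (E →L[ℝ] ℝ) := by
      rw [← (LinearMap.toContinuousLinearMap (𝕜 := ℝ) (E := E) (F' := ℝ)).finrank_eq]
      exact (Subspace.dual_finrank_eq).symm
    exact ⟨(LinearMap.linearEquivOfInjective _ inj rank).toContinuousLinearEquiv, by ext; rfl⟩
  let b : M → E →L[ℝ] ℝ := inTangentCoordinates I 𝓘(ℝ, ℝ) id f (mfderiv I 𝓘(ℝ, ℝ) f) x
  have hb : CMDiffAt ∞ b x := (hf x).mfderiv_const le_rfl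
  have b_apply {y : M} (hy : y ∈ e.baseSet) (w : E) : b y w = mvfderiv I f y (e.symm y w) := by
    simp only [b, inTangentCoordinates, ContinuousLinearMap.inCoordinates,
      TangentBundle.continuousLinearMapAt_model_space]
    rw [← e.symmL_apply (R := ℝ) hy]
    rfl
  have key {y : M} (hy : y ∈ e.baseSet) :
      (e (T% (riemannianGradient (I := I) f) y)).2 = (A y).inverse (b y) := by
    refine ((A_inv hy).inverse_apply_eq.2 ?_).symm
    ext w
    rw [A_apply hy, b_apply hy, e.symm_apply_apply_mk hy, inner_riemannianGradient]
  rw [contMDiffAt_section]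
  have hinv : CMDiffAt ∞ (fun y ↦ (A y).inverse) x := by
    obtain ⟨L, hL⟩ := A_inv hxe
    have := contDiffAt_map_inverse (𝕜 := ℝ) (n := ∞) L
    rw [hL] at this
    exact this.contMDiffAt.comp x hA
  refine (hinv.clm_apply hb).congr_of_eventuallyEq ?_
  filter_upwards [e.open_baseSet.mem_nhds hxe] with y hy using key hy

end Gradient

section Kenmotsu

open VectorField

variable {E : Type*} [NormedAddCommGroup E] [NormedSpace ℝ E] [FiniteDimensional ℝ E]
  {H : Type*} [TopologicalSpace H] {I : ModelWithCorners ℝ E H}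
  {M : Type*} [TopologicalSpace M] [ChartedSpace H M] [IsManifold I ∞ M]
  [RiemannianBundle (fun x : M ↦ TangentSpace I x)]
  [IsContMDiffRiemannianBundle I ∞ E (fun x : M ↦ TangentSpace I x)]
  {φ : Π x : M, TangentSpace I x →L[ℝ] TangentSpace I x}
  {ξ : Π x : M, TangentSpace I x} {η : Π x : M, TangentSpace I x →L[ℝ] ℝ}

namespace IsAlmostContactMetric

theorem phi_xi (h : IsAlmostContactMetric φ ξ η) (x : M) : φ x (ξ x) = 0 := by
  rw [← inner_self_eq_zero (𝕜 := ℝ), h.inner_phi_phi, ← h.eta_eq, h.eta_xi]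
  norm_num

theorem eta_phi (h : IsAlmostContactMetric φ ξ η) (x : M) (v : TangentSpace I x) :
    η x (φ x v) = 0 := by
  have h1 := h.phi_phi x (φ x v)
  rw [h.phi_phi x v, map_add, map_neg, map_smul, h.phi_xi, smul_zero, add_zero] at h1
  have h2 := congr(η x $h1)
  simpa [h.eta_xi] using h2

theorem mdiffAt_xi (h : IsAlmostContactMetric φ ξ η) (x : M) : MDiffAt (T% ξ) x :=
  h.smooth_xi.mdifferentiable (by simp) x

theorem eta_apply_eq (h : IsAlmostContactMetric φ ξ η) (X : Π x : M, TangentSpace I x) :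
    (fun y ↦ η y (X y)) = fun y ↦ inner ℝ (X y) (ξ y) :=
  funext fun y ↦ h.eta_eq y (X y)

theorem mdiffAt_eta (h : IsAlmostContactMetric φ ξ η) {X : Π x : M, TangentSpace I x} {x : M}
    (hX : MDiffAt (T% X) x) : MDiffAt (fun y ↦ η y (X y)) x := by
  rw [h.eta_apply_eq]
  exact mdiffAt_inner hX (h.mdiffAt_xi x)

end IsAlmostContactMetric

theorem leviCivita_sub_leviCivita {X Y : Π x : M, TangentSpace I x} {x : M}
    (hX : MDiffAt (T% X) x) (hY : MDiffAt (T% Y) x) :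
    leviCivita Y x (X x) - leviCivita X x (Y x) = mlieBracket I X Y x :=
  (CovariantDerivative.torsion_eq_zero_iff _).1 leviCivita_torsion hX hY

namespace IsKenmotsu

/-- On a Kenmotsu manifold `∇_X ξ = X - η(X)ξ`. -/
theorem leviCivita_xi [T2Space M] (h : IsKenmotsu φ ξ η) (x : M) (v : TangentSpace I x) :
    leviCivita ξ x v = v - η x v • ξ x := by
  obtain ⟨X, hX, rfl⟩ := exists_contMDiff_vectorField_eq v
  have hXx : MDiffAt (T% X) x := hX.mdifferentiable (by simp) x
  have h1 := h.kenmotsu X ξ hX h.smooth_xi x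
  have h2 : (fun y ↦ φ y (ξ y)) = 0 := funext h.phi_xi
  rw [h2, CovariantDerivative.zero, ← h.eta_eq, h.eta_phi, h.eta_xi] at h1
  have h3 : φ x (leviCivita ξ x (X x)) = φ x (X x) := by simpa using h1
  have h4 : η x (leviCivita ξ x (X x)) = 0 := by
    have h5 := leviCivita_metric hXx (h.mdiffAt_xi x) (h.mdiffAt_xi x)
    have h6 : (fun y ↦ inner ℝ (ξ y) (ξ y)) = fun _ : M ↦ (1 : ℝ) :=
      funext fun y ↦ by rw [← h.eta_eq, h.eta_xi]
    rw [h6, mvfderiv_const, real_inner_comm _ (ξ x), ← h.eta_eq] at h5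
    have : (0 : TangentSpace I x →L[ℝ] ℝ) (X x) = 0 := rfl
    linarith
  have h7 := congr(φ x $h3)
  rw [h.phi_phi, h.phi_phi, h4] at h7
  linear_combination (norm := module) -h7

/-- On a Kenmotsu manifold `(∇_X η)Y = g(X, Y) - η(X)η(Y)`. -/
theorem mvfderiv_eta [T2Space M] (h : IsKenmotsu φ ξ η) {X Y : Π x : M, TangentSpace I x} {x : M}
    (hX : MDiffAt (T% X) x) (hY : MDiffAt (T% Y) x) :
    mvfderiv I (fun y ↦ η y (Y y)) x (X x) =
      η x (leviCivita Y x (X x)) + inner ℝ (X x) (Y x) - η x (X x) * η x (Y x) := by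
  rw [h.eta_apply_eq, leviCivita_metric hX hY (h.mdiffAt_xi x), h.leviCivita_xi,
    inner_sub_right, real_inner_smul_right, ← h.eta_eq, ← h.eta_eq, real_inner_comm (X x)]
  ring

/-- The `1`-form `η` of a Kenmotsu manifold is closed. -/
theorem eta_mlieBracket [T2Space M] (h : IsKenmotsu φ ξ η) {X Y : Π x : M, TangentSpace I x}
    {x : M} (hX : MDiffAt (T% X) x) (hY : MDiffAt (T% Y) x) :
    η x (mlieBracket I X Y x) =
      mvfderiv I (fun y ↦ η y (Y y)) x (X x) - mvfderiv I (fun y ↦ η y (X y)) x (Y x) := by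
  rw [h.mvfderiv_eta hX hY, h.mvfderiv_eta hY hX, ← leviCivita_sub_leviCivita hX hY, map_sub,
    real_inner_comm (X x)]
  ring

/-- The covariant derivative of `∇_Y ξ` on a Kenmotsu manifold. -/
theorem leviCivita_leviCivita_xi [T2Space M] (h : IsKenmotsu φ ξ η)
    {Y : Π x : M, TangentSpace I x} {x : M} (hY : MDiffAt (T% Y) x) (v : TangentSpace I x) :
    leviCivita (fun y ↦ leviCivita ξ y (Y y)) x v =
      leviCivita Y x v - η x (Y x) • (v - η x v • ξ x)
        - mvfderiv I (fun y ↦ η y (Y y)) x v • ξ x := by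
  have e : (fun y ↦ leviCivita ξ y (Y y)) = Y + (-fun y ↦ η y (Y y)) • ξ := by
    ext1 y
    rw [h.leviCivita_xi, Pi.add_apply, Pi.smul_apply', Pi.neg_apply, neg_smul, sub_eq_add_neg]
  have hη := (h.mdiffAt_eta hY).neg
  have cov := (leviCivita : CovariantDerivative I E
    (fun x : M ↦ TangentSpace I x)).isCovariantDerivativeOnUniv
  rw [e]
  refine congr($((cov.add hY (hη.smul_section (h.mdiffAt_xi x))).trans
    congr(_ + $(cov.leibniz (h.mdiffAt_xi x) hη))) v).trans ?_
  change leviCivita Y x v + ((-η x (Y x)) • leviCivita ξ x v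
    + mvfderiv I (-fun y ↦ η y (Y y)) x v • ξ x) = _
  rw [mvfderiv_neg, h.leviCivita_xi, neg_apply]
  module

/-- On a Kenmotsu manifold `R(X, Y)ξ = η(X)Y - η(Y)X`. -/
theorem curvature_xi [T2Space M] (h : IsKenmotsu φ ξ η) {X Y : Π x : M, TangentSpace I x} {x : M}
    (hX : MDiffAt (T% X) x) (hY : MDiffAt (T% Y) x) :
    curvature X Y ξ x = η x (X x) • Y x - η x (Y x) • X x := by
  rw [curvature, h.leviCivita_leviCivita_xi hX, h.leviCivita_leviCivita_xi hY, h.leviCivita_xi,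
    h.eta_mlieBracket hX hY, ← leviCivita_sub_leviCivita hX hY]
  module

/-- On a Kenmotsu manifold `S(X, ξ) = -(dim M - 1) η(X)`. -/
theorem ricci_xi [T2Space M] (h : IsKenmotsu φ ξ η) {X : Π x : M, TangentSpace I x} {x : M}
    (hX : MDiffAt (T% X) x) :
    ricci X ξ x = (1 - Module.finrank ℝ E) * η x (X x) := by
  let b := stdOrthonormalBasis ℝ (TangentSpace I x)
  have term i : inner ℝ (curvature (FiberBundle.extend E (b i)) X ξ x) (b i) =
      inner ℝ (X x) (b i) * inner ℝ (b i) (ξ x) - η x (X x) := by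
    rw [h.curvature_xi (FiberBundle.mdifferentiableAt_extend I E (b i)) hX,
      FiberBundle.extend_apply_self, inner_sub_left, real_inner_smul_left, real_inner_smul_left,
      real_inner_self_eq_norm_sq, b.norm_eq_one, h.eta_eq x (b i)]
    ring
  change ∑ i, inner ℝ (curvature (FiberBundle.extend E (b i)) X ξ x) (b i) = _
  simp only [term, Finset.sum_sub_distrib, Finset.sum_const, Finset.card_univ, Fintype.card_fin,
    nsmul_eq_mul]
  rw [b.sum_inner_mul_inner, ← h.eta_eq]
  rw [show Module.finrank ℝ (TangentSpace I x) = Module.finrank ℝ E from rfl]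
  ring

/-- For a gradient conformal `η`-Ricci soliton on a Kenmotsu manifold, the function `ξf` satisfies
`d(ξf) = c η + df - (ξf) η` with a constant `c`. -/
theorem exists_mvfderiv_mvfderiv_xi [T2Space M] (h : IsKenmotsu φ ξ η)
    {V : Π x : M, TangentSpace I x} {f : M → ℝ} {lam mu p : ℝ}
    (hV : IsGradientConformalEtaRicciSoliton η V f lam mu p) :
    ∃ c : ℝ, ∀ (x : M) (v : TangentSpace I x),
      mvfderiv I (fun y ↦ mvfderiv I f y (ξ y)) x v =
        c * η x v + mvfderiv I f x v - mvfderiv I f x (ξ x) * η x v := by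
  refine ⟨-(1 - Module.finrank ℝ E + (lam - (p / 2 + 1 / (Module.finrank ℝ E : ℝ))) + mu),
    fun x v ↦ ?_⟩
  obtain ⟨X, hX, rfl⟩ := exists_contMDiff_vectorField_eq v
  have hXx : MDiffAt (T% X) x := hX.mdifferentiable (by simp) x
  have hgrad : MDiffAt (T% (riemannianGradient (I := I) f)) x :=
    (contMDiff_riemannianGradient hV.smooth).mdifferentiable (by simp) x
  have e : (fun y ↦ mvfderiv I f y (ξ y)) = fun y ↦ inner ℝ (riemannianGradient f y) (ξ y) :=
    funext fun y ↦ (inner_riemannianGradient f y (ξ y)).symm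
  have hs := hV.soliton X ξ hX h.smooth_xi x
  rw [h.ricci_xi hXx, ← h.eta_eq, h.eta_xi, hessian] at hs
  rw [e, leviCivita_metric hXx hgrad (h.mdiffAt_xi x), h.leviCivita_xi, inner_sub_right,
    real_inner_smul_right, inner_riemannianGradient, inner_riemannianGradient]
  linarith

/-- The potential of a gradient conformal `η`-Ricci soliton on a Kenmotsu manifold satisfies
`df = (ξf) η`. -/
theorem mvfderiv_eq_mvfderiv_xi_mul_eta [T2Space M] (h : IsKenmotsu φ ξ η)
    {V : Π x : M, TangentSpace I x} {f : M → ℝ} {lam mu p : ℝ}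
    (hV : IsGradientConformalEtaRicciSoliton η V f lam mu p) (x : M) (v : TangentSpace I x) :
    mvfderiv I f x v = mvfderiv I f x (ξ x) * η x v := by
  obtain ⟨c, hc⟩ := h.exists_mvfderiv_mvfderiv_xi hV
  obtain ⟨X, hX, rfl⟩ := exists_contMDiff_vectorField_eq v
  have hXx : MDiffAt (T% X) x := hX.mdifferentiable (by simp) x
  let u : M → ℝ := fun y ↦ mvfderiv I f y (ξ y)
  have hu : CMDiff ∞ u := contMDiff_mvfderiv_apply hV.smooth h.smooth_xi
  have expand {Y : Π y : M, TangentSpace I y} (hY : CMDiff ∞ (T% Y)) (w : TangentSpace I x) :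
      mvfderiv I (fun y ↦ mvfderiv I u y (Y y)) x w =
        (c - u x) * mvfderiv I (fun y ↦ η y (Y y)) x w
          + mvfderiv I (fun y ↦ mvfderiv I f y (Y y)) x w
          - η x (Y x) * mvfderiv I u x w := by
    have hη := h.mdiffAt_eta (hY.mdifferentiable (by simp) x)
    have hux : MDiffAt u x := hu.mdifferentiable (by simp) x
    have hfY : MDiffAt (fun y ↦ mvfderiv I f y (Y y)) x :=
      (contMDiff_mvfderiv_apply hV.smooth hY).mdifferentiable (by simp) x
    have hcc : MDiffAt (fun _ : M ↦ c) x := mdifferentiableAt_const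
    have e : (fun y ↦ mvfderiv I u y (Y y)) =
        ((fun _ ↦ c) - u) * (fun y ↦ η y (Y y)) + fun y ↦ mvfderiv I f y (Y y) := by
      ext y
      simp only [u, hc, Pi.add_apply, Pi.mul_apply, Pi.sub_apply]
      ring
    rw [e, mvfderiv_add ((hcc.sub hux).mul hη) hfY, mvfderiv_mul (hcc.sub hux) hη,
      mvfderiv_sub hcc hux, mvfderiv_const]
    simp only [add_apply, smul_apply, sub_apply, zero_apply, smul_eq_mul, Pi.sub_apply]
    ring
  have hξ := h.smooth_xi
  have h1 := mvfderiv_mlieBracket hu hX hξ x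
  rw [expand hX, expand hξ, hc x (mlieBracket I X ξ x), mvfderiv_mlieBracket hV.smooth hX hξ,
    h.eta_mlieBracket hXx (h.mdiffAt_xi x), h.eta_xi, hc x (X x), hc x (ξ x), h.eta_xi] at h1
  simp only [u] at h1
  linarith

end IsKenmotsu

end Kenmotsu

theorem grad_pointwise_collinear_xi_of_gradient_conformal_eta_ricci_soliton
    {n : ℕ} {M : Type*} [TopologicalSpace M] [T2Space M]
    [ChartedSpace (EuclideanSpace ℝ (Fin (2 * n + 1))) M]
    [IsManifold (𝓡 (2 * n + 1)) ∞ M]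
    [RiemannianBundle (fun x : M ↦ TangentSpace (𝓡 (2 * n + 1)) x)]
    [IsContMDiffRiemannianBundle (𝓡 (2 * n + 1)) ∞ (EuclideanSpace ℝ (Fin (2 * n + 1)))
      (fun x : M ↦ TangentSpace (𝓡 (2 * n + 1)) x)]
    (φ : Π x : M, TangentSpace (𝓡 (2 * n + 1)) x →L[ℝ] TangentSpace (𝓡 (2 * n + 1)) x)
    (ξ : Π x : M, TangentSpace (𝓡 (2 * n + 1)) x)
    (η : Π x : M, TangentSpace (𝓡 (2 * n + 1)) x →L[ℝ] ℝ)
    (hM : IsKenmotsu φ ξ η)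
    (V : Π x : M, TangentSpace (𝓡 (2 * n + 1)) x) (f : M → ℝ) (lam mu p : ℝ)
    (hV : IsGradientConformalEtaRicciSoliton η V f lam mu p) :
    (∀ x : M, V x = mvfderiv (𝓡 (2 * n + 1)) f x (ξ x) • ξ x) ∧
    ∀ (X : Π x : M, TangentSpace (𝓡 (2 * n + 1)) x) (x : M),
      mvfderiv (𝓡 (2 * n + 1)) f x (X x) =
        mvfderiv (𝓡 (2 * n + 1)) f x (ξ x) * η x (X x) := by

  have key := hM.mvfderiv_eq_mvfderiv_xi_mul_eta hV
  refine ⟨fun x ↦ ext_inner_right ℝ fun v ↦ ?_, fun X x ↦ key x (X x)⟩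
  rw [hV.eq_gradient, inner_riemannianGradient, key, real_inner_smul_left, hM.eta_eq,
    real_inner_comm]
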